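/- Let S = k[x_1, ..., x_n] and let M be a monomial ideal whose minimal generating set contains, for each i = 1, ..., n, a monomial of the form x_1^{α_i} x_i^{β_i} with α_i ≥ 0 and β_i ≥ 1. Then pd(S/M) = n. -/

import Mathlib

open MvPolynomial

/-- A minimal free resolution of `S ⧸ M`, where `S = k[x_1,…,x_n]`: a (possibly eventually
zero) exact complex of finite free `S`-modules `… → S^{rank 1} → S^{rank 0} → S ⧸ M → 0`
whose differentials have all entries in the irrelevant maximal ideal `(x_1,…,x_n)`
(no invertible entries), so that `rank i` is the `i`-th Betti number `β_i(S ⧸ M)`. -/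
structure MinFreeRes (n : ℕ) (K : Type*) [Field K] (M : Ideal (MvPolynomial (Fin n) K)) where
  rank : ℕ → ℕ
  d : ∀ i : ℕ, (Fin (rank (i + 1)) → MvPolynomial (Fin n) K) →ₗ[MvPolynomial (Fin n) K]
        (Fin (rank i) → MvPolynomial (Fin n) K)
  aug : (Fin (rank 0) → MvPolynomial (Fin n) K) →ₗ[MvPolynomial (Fin n) K]
        (MvPolynomial (Fin n) K ⧸ M)
  aug_surjective : Function.Surjective aug
  exact_zero : LinearMap.ker aug = LinearMap.range (d 0)
  exact_succ : ∀ i : ℕ, LinearMap.ker (d i) = LinearMap.range (d (i + 1))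
  minimal : ∀ i : ℕ, ∀ x, ∀ j, d i x j ∈
    Ideal.span (Set.range (MvPolynomial.X : Fin n → MvPolynomial (Fin n) K))

/-- Vectors all of whose coordinates lie in an ideal `I` are preserved by linear maps
between finite free modules. -/
lemma LinearMap.apply_mem_of_forall_mem {A : Type*} [CommRing A] {p q : ℕ}
    (f : (Fin p → A) →ₗ[A] (Fin q → A)) {I : Ideal A} {v : Fin p → A} (hv : ∀ c, v c ∈ I)
    (c : Fin q) : f v c ∈ I := by
  rw [LinearMap.pi_apply_eq_sum_univ f v, Finset.sum_apply]
  exact I.sum_mem fun i _ => I.mul_mem_right _ (hv i)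

/-- The ideal generated by the first `j` variables. -/
noncomputable def firstVarsIdeal (n : ℕ) (K : Type*) [Field K] (j : ℕ) :
    Ideal (MvPolynomial (Fin n) K) :=
  Ideal.span (X '' {i : Fin n | (i : ℕ) < j})

section firstVarsIdeal

variable {n : ℕ} {K : Type*} [Field K]

lemma firstVarsIdeal_zero : firstVarsIdeal n K 0 = ⊥ := by
  simp [firstVarsIdeal]

lemma firstVarsIdeal_self :
    firstVarsIdeal n K n = Ideal.span (Set.range (X : Fin n → MvPolynomial (Fin n) K)) := by
  simp [firstVarsIdeal]

lemma one_notMem_firstVarsIdeal (j : ℕ) : (1 : MvPolynomial (Fin n) K) ∉ firstVarsIdeal n K j := by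
  rw [firstVarsIdeal, mem_ideal_span_X_image]
  simp

lemma firstVarsIdeal_le_succ (j : ℕ) : firstVarsIdeal n K j ≤ firstVarsIdeal n K (j + 1) :=
  Ideal.span_mono (Set.image_mono fun _ hi => Nat.lt_succ_of_lt hi)

lemma X_mem_firstVarsIdeal_succ {j : ℕ} (hj : j < n) :
    (X ⟨j, hj⟩ : MvPolynomial (Fin n) K) ∈ firstVarsIdeal n K (j + 1) :=
  Ideal.subset_span ⟨⟨j, hj⟩, Nat.lt_succ_self j, rfl⟩

lemma exists_sub_mem_of_mem_firstVarsIdeal_succ {j : ℕ} (hj : j < n)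
    {f : MvPolynomial (Fin n) K} (hf : f ∈ firstVarsIdeal n K (j + 1)) :
    ∃ g, f - X ⟨j, hj⟩ * g ∈ firstVarsIdeal n K j := by
  have h : {i : Fin n | (i : ℕ) < j + 1} = insert ⟨j, hj⟩ {i : Fin n | (i : ℕ) < j} := by
    ext i
    simp only [Set.mem_ofPred_eq, Set.mem_insert_iff, Fin.ext_iff]
    omega
  rw [firstVarsIdeal, h, Set.image_insert_eq, Ideal.mem_span_insert] at hf
  obtain ⟨a, z, hz, rfl⟩ := hf
  refine ⟨a, ?_⟩
  rwa [mul_comm a, add_sub_cancel_left]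

/-- The variables form a regular sequence. -/
lemma mem_firstVarsIdeal_of_X_mul_mem {j : ℕ} (hj : j < n) {f : MvPolynomial (Fin n) K}
    (hf : X ⟨j, hj⟩ * f ∈ firstVarsIdeal n K j) : f ∈ firstVarsIdeal n K j := by
  rw [firstVarsIdeal, mem_ideal_span_X_image] at hf ⊢
  intro m hm
  obtain ⟨i, hi, hmi⟩ := hf (Finsupp.single ⟨j, hj⟩ 1 + m) (by
    rw [mem_support_iff, coeff_X_mul]
    exact mem_support_iff.mp hm)
  refine ⟨i, hi, ?_⟩
  have hne : (⟨j, hj⟩ : Fin n) ≠ i := by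
    rintro rfl
    exact lt_irrefl j hi
  simpa [Finsupp.single_apply, hne] using hmi

end firstVarsIdeal

namespace MinFreeRes

variable {n : ℕ} {K : Type*} [Field K] {M : Ideal (MvPolynomial (Fin n) K)}

lemma d_d (R : MinFreeRes n K M) (i : ℕ) (v : Fin (R.rank (i + 2)) → MvPolynomial (Fin n) K) :
    R.d i (R.d (i + 1) v) = 0 := by
  rw [← LinearMap.mem_ker, R.exact_succ]
  exact ⟨v, rfl⟩

/-- Modulo the first `j` variables the resolution stays exact in degrees larger than `j`. -/
lemma exact_mod_firstVars (R : MinFreeRes n K M) (j : ℕ) (hj : j ≤ n) (i : ℕ) (hi : j ≤ i)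
    (z : Fin (R.rank (i + 1)) → MvPolynomial (Fin n) K)
    (hz : ∀ c, R.d i z c ∈ firstVarsIdeal n K j) :
    ∃ w, ∀ c, (z - R.d (i + 1) w) c ∈ firstVarsIdeal n K j := by
  induction j generalizing i with
  | zero =>
    have h : z ∈ LinearMap.ker (R.d i) := by
      ext1 c
      simpa [firstVarsIdeal_zero] using hz c
    rw [R.exact_succ] at h
    obtain ⟨w, rfl⟩ := h
    exact ⟨w, by simp⟩
  | succ j ih =>
    obtain ⟨i, rfl⟩ : ∃ i', i = i' + 1 := ⟨i - 1, by omega⟩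
    have hjn : j < n := hj
    choose y hy using fun c => exists_sub_mem_of_mem_firstVarsIdeal_succ hjn (hz c)
    have hdy : ∀ c, R.d i y c ∈ firstVarsIdeal n K j := fun c => by
      apply mem_firstVarsIdeal_of_X_mul_mem hjn
      have h := (R.d i).apply_mem_of_forall_mem
        (v := R.d (i + 1) z - (X ⟨j, hjn⟩ : MvPolynomial (Fin n) K) • y) hy c
      rw [map_sub, d_d, map_smul, zero_sub] at h
      simpa using h
    obtain ⟨w, hw⟩ := ih hjn.le i (by omega) y hdy
    obtain ⟨v, hv⟩ := ih hjn.le (i + 1) (by omega)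
      (z - (X ⟨j, hjn⟩ : MvPolynomial (Fin n) K) • w) (fun c => by
        have h := add_mem (hy c) (Ideal.mul_mem_left _ (X ⟨j, hjn⟩) (hw c))
        convert h using 1
        simp only [map_sub, map_smul, Pi.sub_apply, Pi.smul_apply, smul_eq_mul]
        ring)
    refine ⟨v, fun c => ?_⟩
    have h := add_mem (firstVarsIdeal_le_succ j (hv c))
      (Ideal.mul_mem_right (w c) _ (X_mem_firstVarsIdeal_succ (K := K) hjn))
    convert h using 1
    simp only [Pi.sub_apply, Pi.smul_apply, smul_eq_mul]
    ring

/-- The Betti numbers beyond the number of variables vanish. -/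
lemma rank_eq_zero_of_lt (R : MinFreeRes n K M) {i : ℕ} (hi : n < i) : R.rank i = 0 := by
  obtain ⟨i, rfl⟩ : ∃ i', i = i' + 1 := ⟨i - 1, by omega⟩
  by_contra hne
  let c : Fin (R.rank (i + 1)) := ⟨0, Nat.pos_of_ne_zero hne⟩
  obtain ⟨w, hw⟩ := R.exact_mod_firstVars n le_rfl i (by omega) (fun _ => 1) (fun c => by
    rw [firstVarsIdeal_self]
    exact R.minimal i _ c)
  have hd : R.d (i + 1) w c ∈ firstVarsIdeal n K n := by
    rw [firstVarsIdeal_self]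
    exact R.minimal (i + 1) w c
  apply one_notMem_firstVarsIdeal (n := n) (K := K) n
  simpa using add_mem (hw c) hd

/-- A socle element of `S ⧸ M` lifts to a nonzero class in degree `j` annihilated by all variables,
in the homology of the resolution modulo the first `j` variables. -/
lemma exists_socle_class (R : MinFreeRes n K M) {u : MvPolynomial (Fin n) K} (hu : u ∉ M)
    (hXu : ∀ i, X i * u ∈ M) (j : ℕ) (hj : j ≤ n) :
    ∃ z : Fin (R.rank j) → MvPolynomial (Fin n) K,
      (∀ i : Fin n, ∃ w, ∀ c,
        ((X i : MvPolynomial (Fin n) K) • z - R.d j w) c ∈ firstVarsIdeal n K j) ∧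
      ¬ ∃ w, ∀ c, (z - R.d j w) c ∈ firstVarsIdeal n K j := by
  induction j with
  | zero =>
    obtain ⟨z, hz⟩ := R.aug_surjective (Ideal.Quotient.mk M u)
    refine ⟨z, fun i => ?_, ?_⟩
    · have h : (X i : MvPolynomial (Fin n) K) • z ∈ LinearMap.ker R.aug := by
        rw [LinearMap.mem_ker, map_smul, hz]
        exact Ideal.Quotient.eq_zero_iff_mem.mpr (hXu i)
      rw [R.exact_zero] at h
      obtain ⟨w, hw⟩ := h
      exact ⟨w, by simp [hw]⟩
    · rintro ⟨w, hw⟩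
      have h : z = R.d 0 w := by
        ext1 c
        simpa [firstVarsIdeal_zero, sub_eq_zero] using hw c
      have h' : z ∈ LinearMap.ker R.aug := by
        rw [R.exact_zero]
        exact ⟨w, h.symm⟩
      rw [LinearMap.mem_ker, hz] at h'
      exact hu (Ideal.Quotient.eq_zero_iff_mem.mp h')
  | succ j ih =>
    have hjn : j < n := hj
    obtain ⟨z, hz, hz'⟩ := ih hjn.le
    obtain ⟨w, hw⟩ := hz ⟨j, hjn⟩
    refine ⟨w, fun i => ?_, ?_⟩
    · obtain ⟨u, hu⟩ := hz i
      obtain ⟨t, ht⟩ := R.exact_mod_firstVars j hjn.le j le_rfl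
        ((X i : MvPolynomial (Fin n) K) • w - (X ⟨j, hjn⟩ : MvPolynomial (Fin n) K) • u)
        (fun c => by
          have h := sub_mem (Ideal.mul_mem_left _ (X ⟨j, hjn⟩) (hu c))
            (Ideal.mul_mem_left _ (X i) (hw c))
          convert h using 1
          simp only [map_sub, map_smul, Pi.sub_apply, Pi.smul_apply, smul_eq_mul]
          ring)
      refine ⟨t, fun c => ?_⟩
      have h := add_mem (firstVarsIdeal_le_succ j (ht c))
        (Ideal.mul_mem_right (u c) _ (X_mem_firstVarsIdeal_succ (K := K) hjn))
      convert h using 1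
      simp only [Pi.sub_apply, Pi.smul_apply, smul_eq_mul]
      ring
    · rintro ⟨v, hv⟩
      choose b hb using fun c => exists_sub_mem_of_mem_firstVarsIdeal_succ hjn (hv c)
      refine hz' ⟨b, fun c => mem_firstVarsIdeal_of_X_mul_mem hjn ?_⟩
      have h := (R.d j).apply_mem_of_forall_mem
        (v := w - R.d (j + 1) v - (X ⟨j, hjn⟩ : MvPolynomial (Fin n) K) • b) hb c
      rw [map_sub, map_sub, d_d, map_smul] at h
      convert add_mem (hw c) h using 1
      simp only [Pi.sub_apply, Pi.smul_apply, smul_eq_mul, Pi.zero_apply]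
      ring

lemma rank_ne_zero_of_socle (R : MinFreeRes n K M) {u : MvPolynomial (Fin n) K} (hu : u ∉ M)
    (hXu : ∀ i, X i * u ∈ M) : R.rank n ≠ 0 := by
  intro h0
  obtain ⟨z, -, hz⟩ := R.exists_socle_class hu hXu n le_rfl
  exact hz ⟨0, fun c => (Fin.cast h0 c).elim0⟩

end MinFreeRes

/-- A set of exponents containing, as minimal elements, one of the form `α e₀ + β eᵢ` for each `i`
has a socle exponent: one outside the up-set it generates, all of whose covers are inside. -/
lemma exists_socle_exponent {n : ℕ} (hn : 0 < n) (G : Finset (Fin n →₀ ℕ))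
    (hmingen : ∀ g ∈ G, ∀ g' ∈ G, (∀ j, g j ≤ g' j) → g = g')
    (hG : ∀ i : Fin n, ∃ α β : ℕ, 1 ≤ β ∧
      Finsupp.single (⟨0, hn⟩ : Fin n) α + Finsupp.single i β ∈ G) :
    ∃ u : Fin n →₀ ℕ, (∀ g ∈ G, ¬ g ≤ u) ∧ ∀ i, ∃ g ∈ G, g ≤ Finsupp.single i 1 + u := by
  set o : Fin n := ⟨0, hn⟩
  choose α β hβ hmem using hG
  obtain ⟨a, ha⟩ : ∃ a, a + 1 = α o + β o := ⟨α o + β o - 1, by have := hβ o; omega⟩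
  have hpow : Finsupp.single o (a + 1) ∈ G := by
    rw [ha, Finsupp.single_add]
    exact hmem o
  have hα : ∀ i, i ≠ o → α i ≤ a := by
    intro i hi
    by_contra! hlt
    have h := hmingen _ hpow _ (hmem i) (Finsupp.le_def.mp
      ((Finsupp.single_mono hlt).trans (le_add_of_nonneg_right zero_le)))
    have h' := DFunLike.congr_fun h i
    have := hβ i
    simp [hi.symm] at h'
    omega
  let T : Set (Fin n →₀ ℕ) := {u | (∀ g ∈ G, ¬ g ≤ u) ∧ a ≤ u o}
  have hfin : T.Finite := by
    refine (Set.finite_Iic (Finsupp.equivFunOnFinite.symm fun i => a + β i)).subset ?_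
    rintro u ⟨hu, hua⟩ i
    by_contra! hlt
    simp only [Finsupp.equivFunOnFinite_symm_apply_apply] at hlt
    by_cases hi : i = o
    · subst hi
      refine hu _ hpow (Finsupp.single_le_iff.mpr ?_)
      have := hβ o
      omega
    · refine hu _ (hmem i) fun k => ?_
      have := hα i hi
      by_cases hk : k = o
      · subst hk
        simp [hi]
        omega
      · by_cases hki : k = i
        · subst hki
          simp [Ne.symm hi]
          omega
        · simp [Ne.symm hk, Ne.symm hki]
  have hne : T.Nonempty := by
    refine ⟨Finsupp.single o a, fun g hg hle => ?_, by simp⟩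
    have h := hmingen g hg _ hpow
      (Finsupp.le_def.mp (hle.trans (Finsupp.single_mono (Nat.le_succ a))))
    subst h
    simpa using hle o
  obtain ⟨u, hu⟩ := hfin.exists_maximal hne
  refine ⟨u, hu.prop.1, fun i => ?_⟩
  by_contra! hcon
  have h := hu.le_of_ge (y := Finsupp.single i 1 + u)
    ⟨hcon, hu.prop.2.trans (by simp)⟩ (le_add_of_nonneg_left zero_le) i
  simp at h

/-- If the minimal generating set `G` of a monomial ideal `M ⊆ S = k[x_1,…,x_n]` contains, for
each `i = 1,…,n`, a monomial of the form `x_1^{α_i} x_i^{β_i}` with `α_i ≥ 0` and `β_i ≥ 1`,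
then `pd (S ⧸ M) = n`: in any minimal free resolution of `S ⧸ M` the `n`-th Betti number is
nonzero and all Betti numbers beyond the `n`-th vanish.  (Monomials are recorded by their
exponent vectors `Fin n →₀ ℕ`; minimality of `G` says no generator divides another.) -/
theorem projdim_eq_n_of_special_generators (n : ℕ) (hn : 0 < n) (K : Type*) [Field K]
    (M : Ideal (MvPolynomial (Fin n) K)) (G : Finset (Fin n →₀ ℕ))
    (hspan : M = Ideal.span
      ((fun d => (monomial d (1 : K) : MvPolynomial (Fin n) K)) '' (G : Set (Fin n →₀ ℕ))))
    (hmingen : ∀ g ∈ G, ∀ g' ∈ G, (∀ j, g j ≤ g' j) → g = g')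
    (hG : ∀ i : Fin n, ∃ α β : ℕ, 1 ≤ β ∧
      Finsupp.single (⟨0, hn⟩ : Fin n) α + Finsupp.single i β ∈ G)
    (R : MinFreeRes n K M) :
    R.rank n ≠ 0 ∧ ∀ i : ℕ, n < i → R.rank i = 0 := by
  obtain ⟨u, hu, hXu⟩ := exists_socle_exponent hn G hmingen hG
  refine ⟨R.rank_ne_zero_of_socle (u := monomial u 1) ?_ fun i => ?_,
    fun i hi => R.rank_eq_zero_of_lt hi⟩
  · rw [hspan, mem_ideal_span_monomial_image]
    intro h
    obtain ⟨g, hg, hle⟩ := h u (by simp [mem_support_iff])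
    exact hu g hg hle
  · rw [hspan, mem_ideal_span_monomial_image]
    intro m hm
    rw [X, monomial_mul, one_mul] at hm
    rw [Finset.mem_singleton.mp (support_monomial_subset hm)]
    exact hXu i
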